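/- Fix ε ∈ (0,1). Let ψ: ℕ → ℝ_{≥0} be a function, let Q ≥ 1 and y ≥ 1. Then ∑∑_{(q,r)∈[1,Q]², D(q,r) ≤ y} (ψ(q)φ(q)/q)·(ψ(r)φ(r)/r) ≪_ε y^{1−ε}·Ψ(Q)^{1+ε}, uniformly in ψ, Q and y, where the implied constant depends only on ε. -/

import Mathlib

/-- `Ψ(Q) = 2 ∑_{q ≤ Q} φ(q) ψ(q) / q`. -/
noncomputable def Psi (ψ : ℕ → ℝ) (Q : ℕ) : ℝ :=
  2 * ∑ q ∈ Finset.Icc 1 Q, (Nat.totient q : ℝ) * ψ q / q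

/-- `D(q,r) = max(r ψ(q), q ψ(r)) / gcd(q,r)`. -/
noncomputable def Dfun (ψ : ℕ → ℝ) (q r : ℕ) : ℝ :=
  max ((r : ℝ) * ψ q) ((q : ℝ) * ψ r) / (Nat.gcd q r : ℝ)

/-- `L_t(q,r) = ∑_{p | qr/gcd(q,r)², p > t} 1/p`. -/
noncomputable def Lfun (t : ℝ) (q r : ℕ) : ℝ :=
  ∑ p ∈ (q * r / Nat.gcd q r ^ 2).primeFactors.filter (fun p : ℕ => t < (p : ℝ)), (1 : ℝ) / p

/-- `ω_t(q,r) = #{p prime : p | qr/gcd(q,r)², p ≤ t}`. -/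
noncomputable def omegaFun (t : ℝ) (q r : ℕ) : ℕ :=
  ((q * r / Nat.gcd q r ^ 2).primeFactors.filter (fun p : ℕ => (p : ℝ) ≤ t)).card


def ker (r : ℝ) (i j : ℕ) : ℝ := r ^ ((i - j) + (j - i))

theorem ker_nonneg {r : ℝ} (hr : 0 ≤ r) (i j : ℕ) : 0 ≤ ker r i j := by
  unfold ker; positivity

theorem ker_comm (r : ℝ) (i j : ℕ) : ker r i j = ker r j i := by
  unfold ker; rw [add_comm]

theorem geo_inj {r : ℝ} (h0 : 0 ≤ r) (h1 : r < 1) (A : Finset ℕ) (f : ℕ → ℕ)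
    (hf : Set.InjOn f A) : ∑ j ∈ A, r ^ (f j) ≤ 1 / (1 - r) := by
  classical
  rw [← Finset.sum_image (f := fun m => r ^ m) hf, one_div, ← tsum_geometric_of_lt_one h0 h1]
  exact (summable_geometric_of_lt_one h0 h1).sum_le_tsum _ (fun i _ => by positivity)

theorem row_off {r : ℝ} (h0 : 0 ≤ r) (h1 : r < 1) (T : Finset ℕ) (i : ℕ) :
    ∑ j ∈ T.erase i, ker r i j ≤ 2 * r / (1 - r) := by
  rw [← Finset.sum_filter_add_sum_filter_not (T.erase i) (fun j => j < i)]
  have e1 : ∑ j ∈ (T.erase i).filter (fun j => j < i), ker r i j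
      = r * ∑ j ∈ (T.erase i).filter (fun j => j < i), r ^ (i - j - 1) := by
    rw [Finset.mul_sum]
    apply Finset.sum_congr rfl
    intro j hj
    simp only [Finset.mem_filter, Finset.mem_erase] at hj
    rw [ker, ← pow_succ']; congr 1; omega
  have e2 : ∑ j ∈ (T.erase i).filter (fun j => ¬ j < i), ker r i j
      = r * ∑ j ∈ (T.erase i).filter (fun j => ¬ j < i), r ^ (j - i - 1) := by
    rw [Finset.mul_sum]
    apply Finset.sum_congr rfl
    intro j hj
    simp only [Finset.mem_filter, Finset.mem_erase] at hj
    rw [ker, ← pow_succ']; congr 1; omega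
  rw [e1, e2]
  have g1 := geo_inj h0 h1 ((T.erase i).filter (fun j => j < i)) (fun j => i - j - 1) (by
    intro x hx y hy h
    simp only [Finset.coe_filter, Finset.mem_erase, Set.mem_ofPred_eq] at hx hy h
    omega)
  have g2 := geo_inj h0 h1 ((T.erase i).filter (fun j => ¬ j < i)) (fun j => j - i - 1) (by
    intro x hx y hy h
    simp only [Finset.coe_filter, Finset.mem_erase, Set.mem_ofPred_eq] at hx hy h
    omega)
  have := mul_le_mul_of_nonneg_left g1 h0
  have := mul_le_mul_of_nonneg_left g2 h0
  have : 2 * r / (1 - r) = r * (1 / (1-r)) + r * (1/(1-r)) := by ring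
  linarith

theorem row_all {r : ℝ} (h0 : 0 ≤ r) (h1 : r < 1) (T : Finset ℕ) (i : ℕ) :
    ∑ j ∈ T, ker r i j ≤ 1 + 2 * r / (1 - r) := by
  have h := row_off h0 h1 T i
  have : ∑ j ∈ T, ker r i j ≤ ∑ j ∈ insert i (T.erase i), ker r i j := by
    apply Finset.sum_le_sum_of_subset_of_nonneg
    · intro x hx; by_cases h : x = i <;> simp [h, hx]
    · intros; exact ker_nonneg h0 _ _
  rw [Finset.sum_insert (by simp)] at this
  have e : ker r i i = 1 := by simp [ker]
  linarith

/-- Schur-type bound with a general nonnegative kernel. -/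
theorem schur {T : Finset ℕ} (k : ℕ → ℕ → ℝ) (hk : ∀ i j, 0 ≤ k i j) (hs : ∀ i j, k i j = k j i)
    {R : ℝ} (hR : ∀ i, ∑ j ∈ T, k i j ≤ R) (x y : ℕ → ℝ) :
    ∑ i ∈ T, ∑ j ∈ T, k i j * (x i * y j) ≤ R * ((∑ i ∈ T, x i ^ 2 + ∑ i ∈ T, y i ^ 2) / 2) := by
  have h1 : ∑ i ∈ T, ∑ j ∈ T, k i j * (x i * y j) ≤
      ∑ i ∈ T, ∑ j ∈ T, (k i j * (x i ^ 2 / 2) + k i j * (y j ^ 2 / 2)) := by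
    refine Finset.sum_le_sum fun i _ => Finset.sum_le_sum fun j _ => ?_
    nlinarith [mul_nonneg (hk i j) (sq_nonneg (x i - y j))]
  have h2 : ∑ i ∈ T, ∑ j ∈ T, k i j * (x i ^ 2 / 2) ≤ ∑ i ∈ T, R * (x i ^ 2 / 2) := by
    refine Finset.sum_le_sum fun i _ => ?_
    rw [← Finset.sum_mul]
    exact mul_le_mul_of_nonneg_right (hR i) (by positivity)
  have h3 : ∑ i ∈ T, ∑ j ∈ T, k i j * (y j ^ 2 / 2) ≤ ∑ i ∈ T, R * (y i ^ 2 / 2) := by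
    rw [Finset.sum_comm]
    refine Finset.sum_le_sum fun i _ => ?_
    rw [← Finset.sum_mul]
    refine mul_le_mul_of_nonneg_right ?_ (by positivity)
    simp_rw [fun j => hs j i]
    exact hR i
  simp only [Finset.sum_add_distrib] at h1
  rw [← Finset.mul_sum, ← Finset.sum_div] at h2 h3
  linarith [h1, h2, h3]

theorem sum_rpow_le {T : Finset ℕ} {x : ℕ → ℝ} (hx : ∀ i, 0 ≤ x i) {u a : ℝ} (hu : 1 < u)
    (ha : ∑ i ∈ T, x i ≤ a) : ∑ i ∈ T, x i ^ u ≤ a ^ u := by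
  have ha0 : 0 ≤ a := le_trans (Finset.sum_nonneg fun i _ => hx i) ha
  have hsp : ∀ z : ℝ, 0 ≤ z → z ^ u = z * z ^ (u - 1) := by
    intro z hz
    rcases hz.eq_or_lt with h | h
    · rw [← h, Real.zero_rpow (by linarith)]; simp
    · rw [← Real.rpow_one_add' hz (by linarith)]; congr 1; ring
  calc ∑ i ∈ T, x i ^ u ≤ ∑ i ∈ T, x i * a ^ (u - 1) := by
        refine Finset.sum_le_sum fun i hi => ?_
        rw [hsp _ (hx i)]
        have : x i ≤ a := le_trans (Finset.single_le_sum (fun i _ => hx i) hi) ha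
        exact mul_le_mul_of_nonneg_left (Real.rpow_le_rpow (hx i) this (by linarith)) (hx i)
    _ = (∑ i ∈ T, x i) * a ^ (u - 1) := by rw [Finset.sum_mul]
    _ ≤ a * a ^ (u-1) := mul_le_mul_of_nonneg_right ha (by positivity)
    _ = a ^ u := (hsp a ha0).symm

theorem schur_rpow {T : Finset ℕ} {k : ℕ → ℕ → ℝ} (hk : ∀ i j, 0 ≤ k i j)
    (hs : ∀ i j, k i j = k j i) {R : ℝ} (hR : ∀ i, ∑ j ∈ T, k i j ≤ R) (hR0 : 0 ≤ R)
    {α β : ℕ → ℝ} (hα : ∀ i, 0 ≤ α i) (hβ : ∀ i, 0 ≤ β i) {t a b : ℝ} (ht : 1 / 2 < t)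
    (ha : ∑ i ∈ T, α i ≤ a) (hb : ∑ i ∈ T, β i ≤ b) :
    ∑ i ∈ T, ∑ j ∈ T, k i j * (α i ^ t * β j ^ t) ≤ R * ((a ^ (2 * t) + b ^ (2 * t)) / 2) := by
  refine (schur k hk hs hR _ _).trans (mul_le_mul_of_nonneg_left ?_ hR0)
  have e : ∀ z : ℝ, 0 ≤ z → (z ^ t) ^ 2 = z ^ (2 * t) := by
    intro z hz
    rw [← Real.rpow_natCast, ← Real.rpow_mul hz]; congr 1; push_cast; ring
  have h1 := sum_rpow_le (T := T) hα (u := 2 * t) (by linarith) ha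
  have h2 := sum_rpow_le (T := T) hβ (u := 2 * t) (by linarith) hb
  simp_rw [fun i => e _ (hα i), fun i => e _ (hβ i)]
  linarith

/-- Concentration lemma. -/
theorem concentration {t : ℝ} (ht : 1 / 2 < t) (ht1 : t < 1) :
    ∃ r₀ : ℝ, 0 < r₀ ∧ ∀ r : ℝ, 0 < r → r ≤ r₀ → ∀ (T : Finset ℕ) (α β : ℕ → ℝ),
      (∀ i, 0 ≤ α i) → (∀ i, 0 ≤ β i) → ∑ i ∈ T, α i = 1 → ∑ i ∈ T, β i = 1 →
      1 ≤ ∑ i ∈ T, ∑ j ∈ T, ker r i j * (α i ^ t * β j ^ t) →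
      ∃ k : ℕ, ∑ i ∈ T.erase k, ∑ j ∈ T.erase k, ker r i j * (α i ^ t * β j ^ t)
        ≤ 3 * ((43 * r) ^ (1 / (1 - t))) ^ (2 * t) := by
  set δ := t - 1 / 2 with hδ
  have hδ0 : 0 < δ := by rw [hδ]; linarith
  obtain ⟨τ, hτ0, hτ1, hτ⟩ : ∃ τ : ℝ, 0 < τ ∧ τ < 1 ∧ τ ^ (2 * δ) ≤ 1 / 24 := by
    refine ⟨(1 / 24) ^ (1 / (2 * δ)), by positivity, ?_, ?_⟩
    · exact Real.rpow_lt_one (by norm_num) (by norm_num) (by positivity)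
    · rw [← Real.rpow_mul (by norm_num)]
      rw [one_div_mul_cancel (by positivity), Real.rpow_one]
  have hlt : (1 - τ) ^ δ < 1 := Real.rpow_lt_one (by linarith) (by linarith) hδ0
  refine ⟨min (1 / 2) ((1 - (1 - τ) ^ δ) / 4), lt_min (by norm_num) (by linarith), ?_⟩
  intro r hr0 hr T α β hα hβ hsα hsβ h1
  have hr2 : r ≤ 1 / 2 := hr.trans (min_le_left _ _)
  have hr3 : 4 * r ≤ 1 - (1 - τ) ^ δ := by
    have := hr.trans (min_le_right _ _); linarith
  have hη : 2 * r / (1 - r) ≤ 4 * r := by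
    rw [div_le_iff₀ (by linarith)]; nlinarith
  have hoff : ∀ (T : Finset ℕ) i, ∑ j ∈ T.erase i, ker r i j ≤ 4 * r :=
    fun T i => (row_off hr0.le (by linarith) T i).trans hη
  have hall : ∀ (T : Finset ℕ) i, ∑ j ∈ T, ker r i j ≤ 3 :=
    fun T i => (row_all hr0.le (by linarith) T i).trans (by linarith)
  have hkd : ∀ i, ker r i i = 1 := by intro i; simp [ker]
  have hα1 : ∀ i ∈ T, α i ≤ 1 := fun i hi => by
    rw [← hsα]; exact Finset.single_le_sum (fun i _ => hα i) hi
  have hβ1 : ∀ i ∈ T, β i ≤ 1 := fun i hi => by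
    rw [← hsβ]; exact Finset.single_le_sum (fun i _ => hβ i) hi
  -- maximal k
  have hTne : T.Nonempty := by
    by_contra h
    rw [Finset.not_nonempty_iff_eq_empty] at h
    rw [h] at hsα; simp at hsα
  obtain ⟨k, hkT, hk⟩ := Finset.exists_max_image T (fun i => α i * β i) hTne
  have hdiag : ∑ i ∈ T, α i ^ t * β i ^ t ≤ (α k * β k) ^ δ := by
    calc ∑ i ∈ T, α i ^ t * β i ^ t ≤ ∑ i ∈ T, (α k * β k) ^ δ * ((α i + β i) / 2) := by
          refine Finset.sum_le_sum fun i hi => ?_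
          have hp : 0 ≤ α i * β i := mul_nonneg (hα i) (hβ i)
          have e : α i ^ t * β i ^ t = (α i * β i) ^ δ * Real.sqrt (α i * β i) := by
            rw [← Real.mul_rpow (hα i) (hβ i), Real.sqrt_eq_rpow,
              ← Real.rpow_add_of_nonneg hp hδ0.le (by norm_num)]
            congr 1; rw [hδ]; ring
          rw [e]
          refine mul_le_mul (Real.rpow_le_rpow hp (hk i hi) hδ0.le) ?_ (Real.sqrt_nonneg _)
            (Real.rpow_nonneg (mul_nonneg (hα k) (hβ k)) _)
          rw [Real.sqrt_le_left (by linarith [hα i, hβ i])]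
          nlinarith [sq_nonneg (α i - β i)]
      _ = (α k * β k) ^ δ := by
          rw [← Finset.mul_sum, ← Finset.sum_div, Finset.sum_add_distrib, hsα, hsβ]; ring
  -- off-diagonal
  have hod : ∑ i ∈ T, ∑ j ∈ T, ker r i j * (α i ^ t * β j ^ t) ≤
      4 * r + ∑ i ∈ T, α i ^ t * β i ^ t := by
    have := schur_rpow (T := T) (k := fun i j => if i = j then 0 else ker r i j)
      (fun i j => by split_ifs; exacts [le_rfl, ker_nonneg hr0.le _ _])
      (fun i j => by simp only [ker_comm r i j, eq_comm])
      (R := 4 * r) (fun i => by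
        refine le_trans ?_ (hoff T i)
        rw [Finset.sum_ite, Finset.sum_const_zero, zero_add]
        apply le_of_eq
        apply Finset.sum_congr _ (fun _ _ => rfl)
        ext x; simp [and_comm, eq_comm]) (by linarith) hα hβ ht hsα.le hsβ.le
    rw [Real.one_rpow] at this
    have e : ∑ i ∈ T, ∑ j ∈ T, ker r i j * (α i ^ t * β j ^ t) =
      ∑ i ∈ T, ∑ j ∈ T, (if i = j then 0 else ker r i j) * (α i ^ t * β j ^ t)
        + ∑ i ∈ T, α i ^ t * β i ^ t := by
      rw [← Finset.sum_add_distrib]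
      refine Finset.sum_congr rfl fun i hi => ?_
      have : α i ^ t * β i ^ t = ∑ j ∈ T, if i = j then α i ^ t * β j ^ t else 0 := by
        rw [Finset.sum_ite_eq, if_pos hi]
      rw [this, ← Finset.sum_add_distrib]
      refine Finset.sum_congr rfl fun j hj => ?_
      split_ifs with h
      · subst h; rw [hkd]; ring
      · ring
    rw [e]; linarith
  have hm : 1 - τ ≤ α k * β k := by
    have h : (1 - τ) ^ δ ≤ (α k * β k) ^ δ := by linarith
    exact (Real.rpow_le_rpow_iff (by linarith) (mul_nonneg (hα k) (hβ k)) hδ0).1 h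
  set a := 1 - α k with ha
  set b := 1 - β k with hb
  have ha0 : 0 ≤ a := by linarith [hα1 k hkT]
  have hb0 : 0 ≤ b := by linarith [hβ1 k hkT]
  have haτ : a ≤ τ := by nlinarith [hα1 k hkT, hβ1 k hkT, hα k, hβ k]
  have hbτ : b ≤ τ := by nlinarith [hα1 k hkT, hβ1 k hkT, hα k, hβ k]
  have hsa : ∑ i ∈ T.erase k, α i = a := by
    rw [← Finset.add_sum_erase T α hkT] at hsα; linarith
  have hsb : ∑ i ∈ T.erase k, β i = b := by
    rw [← Finset.add_sum_erase T β hkT] at hsβ; linarith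
  have h3 : ∑ i ∈ T.erase k, ∑ j ∈ T.erase k, ker r i j * (α i ^ t * β j ^ t)
      ≤ 3 * ((a ^ (2 * t) + b ^ (2 * t)) / 2) :=
    schur_rpow (fun i j => ker_nonneg hr0.le i j) (ker_comm r) (hall _) (by norm_num) hα hβ ht
      hsa.le hsb.le
  have hcross : ∀ (γ : ℕ → ℝ) (c z : ℝ), (∀ i, 0 ≤ γ i) → ∑ i ∈ T.erase k, γ i = c → 0 ≤ z → z ≤ 1 →
      ∑ j ∈ T.erase k, ker r k j * (z ^ t * γ j ^ t) ≤ 4 * r * c ^ t := by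
    intro γ c z hγ hc hz0 hz1
    have hc0 : 0 ≤ c := by rw [← hc]; exact Finset.sum_nonneg fun i _ => hγ i
    calc ∑ j ∈ T.erase k, ker r k j * (z ^ t * γ j ^ t) ≤ ∑ j ∈ T.erase k, ker r k j * c ^ t := by
          refine Finset.sum_le_sum fun j hj => mul_le_mul_of_nonneg_left ?_ (ker_nonneg hr0.le _ _)
          have : γ j ≤ c := by rw [← hc]; exact Finset.single_le_sum (fun i _ => hγ i) hj
          calc z ^ t * γ j ^ t ≤ 1 * c ^ t :=
                mul_le_mul (Real.rpow_le_one hz0 hz1 (by linarith))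
                  (Real.rpow_le_rpow (hγ j) this (by linarith)) (Real.rpow_nonneg (hγ j) _) zero_le_one
            _ = c ^ t := one_mul _
      _ ≤ 4 * r * c ^ t := by
          rw [← Finset.sum_mul]
          exact mul_le_mul_of_nonneg_right (hoff T k) (Real.rpow_nonneg hc0 _)
  have hdec : ∑ i ∈ T, ∑ j ∈ T, ker r i j * (α i ^ t * β j ^ t) =
      α k ^ t * β k ^ t + ∑ j ∈ T.erase k, ker r k j * (α k ^ t * β j ^ t)
      + ∑ j ∈ T.erase k, ker r k j * (β k ^ t * α j ^ t)
      + ∑ i ∈ T.erase k, ∑ j ∈ T.erase k, ker r i j * (α i ^ t * β j ^ t) := by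
    rw [← Finset.add_sum_erase T _ hkT, ← Finset.add_sum_erase T _ hkT, hkd, one_mul,
      add_assoc _ _ (∑ i ∈ T.erase k, ∑ j ∈ T.erase k, ker r i j * (α i ^ t * β j ^ t)),
      ← Finset.sum_add_distrib]
    congr 1
    refine Finset.sum_congr rfl fun i hi => ?_
    rw [← Finset.add_sum_erase T _ hkT, ker_comm r k i, mul_comm (β k ^ t)]
  have c1 := hcross β b (α k) hβ hsb (hα k) (hα1 k hkT)
  have c2 := hcross α a (β k) hα hsa (hβ k) (hβ1 k hkT)
  have hbern : ∀ z : ℝ, 0 ≤ z → z ≤ 1 → z ^ t ≤ 1 - (1 - z) / 2 := by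
    intro z hz0 hz1
    have := rpow_one_add_le_one_add_mul_self (s := z - 1) (by linarith) (p := t) (by linarith) ht1.le
    rw [add_sub_cancel] at this
    nlinarith
  have f1 := hbern _ (hα k) (hα1 k hkT)
  have f2 := hbern _ (hβ k) (hβ1 k hkT)
  have hfirst : α k ^ t * β k ^ t ≤ 1 - (a + b) / 4 := by
    have p1 : 0 ≤ α k ^ t := Real.rpow_nonneg (hα k) _
    have p2 : 0 ≤ β k ^ t := Real.rpow_nonneg (hβ k) _
    have q1 : α k ^ t ≤ 1 := by linarith
    have q2 : β k ^ t ≤ 1 := by linarith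
    nlinarith [mul_le_of_le_one_left p2 q1, mul_le_of_le_one_right p1 q2]
  have hsm : ∀ z : ℝ, 0 ≤ z → z ≤ τ → z ^ (2 * t) ≤ z / 24 := by
    intro z hz hzτ
    have : z ^ (2 * t) = z * z ^ (2 * δ) := by
      rw [← Real.rpow_one_add' hz (by linarith)]; congr 1; rw [hδ]; ring
    rw [this]
    have := Real.rpow_le_rpow hz hzτ (z := 2 * δ) (by linarith)
    have := mul_le_mul_of_nonneg_left (this.trans hτ) hz
    linarith
  have g1 := hsm a ha0 haτ
  have g2 := hsm b hb0 hbτ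
  have key : 3 / 16 * (a + b) ≤ 4 * r * (a ^ t + b ^ t) := by
    rw [hdec] at h1
    clear hdec hod hdiag hcross hsm hbern hoff hall
    linarith
  clear_value a b
  set M := max a b with hM
  have hM0 : 0 ≤ M := ha0.trans (le_max_left _ _)
  have hMle : M ≤ (43 * r) ^ (1 / (1 - t)) := by
    have hat : a ^ t ≤ M ^ t := Real.rpow_le_rpow ha0 (le_max_left _ _) (by linarith)
    have hbt : b ^ t ≤ M ^ t := Real.rpow_le_rpow hb0 (le_max_right _ _) (by linarith)
    have hMab : M ≤ a + b := max_le (by linarith) (by linarith)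
    have k2 : M ≤ 43 * r * M ^ t := by
      have q0 : 0 ≤ r * M ^ t := by positivity
      have q1 := mul_le_mul_of_nonneg_left (add_le_add hat hbt) (by linarith : 0 ≤ 4 * r)
      have q2 : 3 / 16 * M ≤ 8 * (r * M ^ t) := by
        calc 3 / 16 * M ≤ 3 / 16 * (a + b) := by linarith only [hMab]
          _ ≤ _ := key
          _ ≤ _ := q1
          _ = _ := by ring
      linarith only [q0, q2]
    rcases hM0.eq_or_lt with h | h
    · rw [← h]; positivity
    · have : M ^ (1 - t) ≤ 43 * r := by
        rw [Real.rpow_sub h, Real.rpow_one, div_le_iff₀ (by positivity)]; exact k2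
      calc M = (M ^ (1 - t)) ^ (1 / (1 - t)) := by
            rw [← Real.rpow_mul hM0, mul_one_div_cancel (by linarith), Real.rpow_one]
        _ ≤ _ := Real.rpow_le_rpow (by positivity) this (by
            apply one_div_nonneg.2; linarith)
  refine ⟨k, h3.trans ?_⟩
  have u1 : a ^ (2 * t) ≤ ((43 * r) ^ (1 / (1 - t))) ^ (2 * t) :=
    Real.rpow_le_rpow ha0 ((le_max_left _ _).trans hMle) (by linarith)
  have u2 : b ^ (2 * t) ≤ ((43 * r) ^ (1 / (1 - t))) ^ (2 * t) :=
    Real.rpow_le_rpow hb0 ((le_max_right _ _).trans hMle) (by linarith)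
  linarith

/-- The hypotheses on a weighted bipartite system. -/
structure Sys (S V W : Finset ℕ) (E : Finset (ℕ × ℕ)) (a b : ℕ → ℕ) (F G : ℕ → ℝ) : Prop where
  F0 : ∀ v, 0 ≤ F v
  G0 : ∀ w, 0 ≤ G w
  ia : Set.InjOn a V
  ib : Set.InjOn b W
  pa : ∀ v ∈ V, a v ≠ 0 ∧ (a v).primeFactors ⊆ S
  pb : ∀ w ∈ W, b w ≠ 0 ∧ (b w).primeFactors ⊆ S
  eV : ∀ e ∈ E, e.1 ∈ V
  eW : ∀ e ∈ E, e.2 ∈ W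
  dF : ∀ e ∈ E, F e.1 * a e.1 * b e.2 ≤ (a e.1).totient * (a e.1).gcd (b e.2)
  dG : ∀ e ∈ E, G e.2 * b e.2 * a e.1 ≤ (b e.2).totient * (a e.1).gcd (b e.2)

def Bd (t C : ℝ) (S : Finset ℕ) : Prop :=
  ∀ (V W : Finset ℕ) (E : Finset (ℕ × ℕ)) (a b : ℕ → ℕ) (F G : ℕ → ℝ), Sys S V W E a b F G →
    ∑ e ∈ E, F e.1 * G e.2 ≤ C * ((∑ v ∈ V, F v) ^ t * (∑ w ∈ W, G w) ^ t)

theorem gcd_pp {p : ℕ} (i j : ℕ) : Nat.gcd (p ^ i) (p ^ j) = p ^ min i j := by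
  rcases le_total i j with h | h
  · rw [min_eq_left h]; exact Nat.gcd_eq_left (pow_dvd_pow _ h)
  · rw [min_eq_right h]; exact Nat.gcd_eq_right (pow_dvd_pow _ h)

theorem gcd_split {p x y : ℕ} (hx : Nat.Coprime p x) (hy : Nat.Coprime p y) (i j : ℕ) :
    Nat.gcd (p ^ i * x) (p ^ j * y) = p ^ min i j * Nat.gcd x y := by
  rw [Nat.Coprime.gcd_mul _ (Nat.Coprime.pow_left j hy),
    Nat.Coprime.gcd_mul_right_cancel _ (Nat.Coprime.pow_right j hx.symm),
    Nat.Coprime.gcd_mul_left_cancel _ (Nat.Coprime.pow_left i hy), gcd_pp]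

theorem cond_div {p x y : ℕ} (hp : p.Prime) (hx : Nat.Coprime p x) (hy : Nat.Coprime p y)
    (i j : ℕ) {f : ℝ} 
    (h : f * (p ^ i * x : ℕ) * (p ^ j * y : ℕ) ≤
      (Nat.totient (p ^ i * x)) * (Nat.gcd (p ^ i * x) (p ^ j * y))) :
    ((p:ℝ) ^ (j - i) * f) * x * y ≤ (Nat.totient x) * Nat.gcd x y := by
  rw [gcd_split hx hy, Nat.totient_mul (Nat.Coprime.pow_left i hx)] at h
  have hpp : (0:ℝ) < p := by exact_mod_cast hp.pos
  have ht : ((p ^ i).totient : ℝ) ≤ (p:ℝ) ^ i := by exact_mod_cast Nat.totient_le _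
  have hj : (p:ℝ) ^ j = p ^ (j - i) * p ^ min i j := by rw [← pow_add]; congr 1; omega
  push_cast at h
  rw [hj] at h
  have hpos : (0:ℝ) < (p:ℝ) ^ i * p ^ min i j := by positivity
  refine le_of_mul_le_mul_left ?_ hpos
  have h2 : ((p ^ i).totient : ℝ) * x.totient * ((p:ℝ) ^ min i j * (x.gcd y : ℕ)) ≤
    (p:ℝ) ^ i * x.totient * ((p:ℝ) ^ min i j * (x.gcd y : ℕ)) := by gcongr
  linarith [h.trans h2]

theorem Sys.slice {S V W : Finset ℕ} {E : Finset (ℕ × ℕ)} {a b : ℕ → ℕ} {F G : ℕ → ℝ}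
    (h : Sys S V W E a b F G) {t C : ℝ} (ht : 0 < t) {p : ℕ} (hp : p.Prime)
    (hB : Bd t C (S.erase p)) (i j : ℕ) :
    ∑ e ∈ E.filter (fun e => (a e.1).factorization p = i ∧ (b e.2).factorization p = j), F e.1 * G e.2
      ≤ C * (ker ((p:ℝ) ^ (-(1 - t))) i j *
        ((∑ v ∈ V.filter (fun v => (a v).factorization p = i), F v) ^ t *
         (∑ w ∈ W.filter (fun w => (b w).factorization p = j), G w) ^ t)) := by
  have hpp : (0:ℝ) < p := by exact_mod_cast hp.pos
  have dec : ∀ (n k : ℕ), n.factorization p = k → p ^ k * (n / p ^ k) = n := by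
    intro n k hk; rw [← hk]; exact Nat.ordProj_mul_ordCompl_eq_self n p
  have cop : ∀ (n k : ℕ), n ≠ 0 → n.factorization p = k → Nat.Coprime p (n / p ^ k) := by
    intro n k hn hk; rw [← hk]; exact Nat.coprime_ordCompl hp hn
  have pf : ∀ (n k : ℕ), n ≠ 0 ∧ n.primeFactors ⊆ S → n.factorization p = k →
      n / p ^ k ≠ 0 ∧ (n / p ^ k).primeFactors ⊆ S.erase p := by
    intro n k hn hk
    have h0 : n / p ^ k ≠ 0 := by
      intro h0; have := dec n k hk; rw [h0, mul_zero] at this; exact hn.1 this.symm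
    refine ⟨h0, fun q hq => ?_⟩
    rw [Finset.mem_erase]
    have hq' := Nat.mem_primeFactors.1 hq
    constructor
    · rintro rfl
      exact (Nat.Prime.coprime_iff_not_dvd hp).1 (cop n k hn.1 hk) hq'.2.1
    · apply hn.2
      exact Nat.mem_primeFactors.2 ⟨hq'.1, hq'.2.1.trans (Dvd.intro_left _ (dec n k hk)), hn.1⟩
  have key := hB (V.filter (fun v => (a v).factorization p = i))
    (W.filter (fun w => (b w).factorization p = j))
    (E.filter (fun e => (a e.1).factorization p = i ∧ (b e.2).factorization p = j))
    (fun v => a v / p ^ i) (fun w => b w / p ^ j)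
    (fun v => (p:ℝ) ^ (j - i) * F v) (fun w => (p:ℝ) ^ (i - j) * G w)
    { F0 := fun v => mul_nonneg (by positivity) (h.F0 v)
      G0 := fun v => mul_nonneg (by positivity) (h.G0 v)
      ia := by
        intro x hx y hy hxy
        simp only [Finset.coe_filter, Set.mem_ofPred_eq] at hx hy hxy
        apply h.ia hx.1 hy.1
        rw [← dec _ _ hx.2, hxy, dec _ _ hy.2]
      ib := by
        intro x hx y hy hxy
        simp only [Finset.coe_filter, Set.mem_ofPred_eq] at hx hy hxy
        apply h.ib hx.1 hy.1
        rw [← dec _ _ hx.2, hxy, dec _ _ hy.2]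
      pa := by
        intro v hv
        rw [Finset.mem_filter] at hv
        exact pf _ _ (h.pa v hv.1) hv.2
      pb := by
        intro v hv
        rw [Finset.mem_filter] at hv
        exact pf _ _ (h.pb v hv.1) hv.2
      eV := by
        intro e he
        rw [Finset.mem_filter] at he ⊢
        exact ⟨h.eV e he.1, he.2.1⟩
      eW := by
        intro e he
        rw [Finset.mem_filter] at he ⊢
        exact ⟨h.eW e he.1, he.2.2⟩
      dF := by
        intro e he
        rw [Finset.mem_filter] at he
        have := h.dF e he.1
        apply cond_div hp (cop _ _ (h.pa _ (h.eV e he.1)).1 he.2.1)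
          (cop _ _ (h.pb _ (h.eW e he.1)).1 he.2.2) i j
        rw [dec _ _ he.2.1, dec _ _ he.2.2]
        exact this
      dG := by
        intro e he
        rw [Finset.mem_filter] at he
        have := h.dG e he.1
        rw [Nat.gcd_comm] at this ⊢
        apply cond_div hp (cop _ _ (h.pb _ (h.eW e he.1)).1 he.2.2)
          (cop _ _ (h.pa _ (h.eV e he.1)).1 he.2.1) j i
        rw [dec _ _ he.2.1, dec _ _ he.2.2]
        exact this }
  rw [← Finset.mul_sum, ← Finset.mul_sum] at key
  set X := ∑ v ∈ V.filter (fun v => (a v).factorization p = i), F v with hX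
  set Y := ∑ w ∈ W.filter (fun w => (b w).factorization p = j), G w with hY
  have hX0 : 0 ≤ X := Finset.sum_nonneg fun v _ => h.F0 v
  have hY0 : 0 ≤ Y := Finset.sum_nonneg fun v _ => h.G0 v
  set n := (i - j) + (j - i) with hn
  have e1 : ∑ e ∈ E.filter (fun e => (a e.1).factorization p = i ∧ (b e.2).factorization p = j),
      (p:ℝ) ^ (j - i) * F e.1 * ((p:ℝ) ^ (i - j) * G e.2) = (p:ℝ) ^ n *
      ∑ e ∈ E.filter (fun e => (a e.1).factorization p = i ∧ (b e.2).factorization p = j),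
        F e.1 * G e.2 := by
    rw [Finset.mul_sum]
    refine Finset.sum_congr rfl fun e _ => ?_
    rw [hn, pow_add]; ring
  rw [e1, Real.mul_rpow (by positivity) hX0, Real.mul_rpow (by positivity) hY0] at key
  have hpn : (0:ℝ) < (p:ℝ) ^ n := by positivity
  refine le_of_mul_le_mul_left (key.trans (le_of_eq ?_)) hpn
  have e2 : ((p:ℝ) ^ (j - i)) ^ t * ((p:ℝ) ^ (i - j)) ^ t = (p:ℝ) ^ n * ker ((p:ℝ) ^ (-(1 - t))) i j := by
    rw [← Real.mul_rpow (by positivity) (by positivity), ← pow_add, add_comm, ker, ← hn,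
      ← mul_pow, ← Real.rpow_one_add' hpp.le, ← Real.rpow_natCast, ← Real.rpow_natCast,
      ← Real.rpow_mul hpp.le, ← Real.rpow_mul hpp.le]
    · congr 1; ring
    · linarith
  linear_combination (C * X ^ t * Y ^ t) * e2

theorem tot_mul_le (g c : ℕ) : (g * c).totient ≤ g.totient * c := by
  induction c using induction_on_primes with
  | zero => simp
  | one => simp
  | prime_mul p c hp ih =>
    have e : g * (p * c) = p * (g * c) := by ring
    have e2 : g.totient * (p * c) = p * (g.totient * c) := by ring
    rw [e, e2]
    by_cases h : p ∣ g * c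
    · rw [Nat.totient_mul_of_prime_of_dvd hp h]; exact Nat.mul_le_mul_left _ ih
    · rw [Nat.totient_mul_of_prime_of_not_dvd hp h]; exact Nat.mul_le_mul (Nat.sub_le _ _) ih

/-- The structured case. -/
theorem structured_half {N : ℕ} (hN : N ≠ 0) (V : Finset ℕ) (a : ℕ → ℕ) (F : ℕ → ℝ) (ia : Set.InjOn a V)
    (ha0 : ∀ v ∈ V, a v ≠ 0) {β : ℝ} (hβ : 0 < β) {L : ℝ} (hL : 0 ≤ L)
    (hF : ∀ v ∈ V, F v ≤ ((a v).gcd N).totient / (N * β))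
    (hV : ∀ v ∈ V, ((a v / (a v).gcd N : ℕ) : ℝ) ≤ L * β) : ∑ v ∈ V, F v ≤ L := by
  have hN' : (0:ℝ) < N := by exact_mod_cast Nat.pos_of_ne_zero hN
  calc ∑ v ∈ V, F v ≤ ∑ v ∈ V, ((a v).gcd N).totient / (N * β) := Finset.sum_le_sum hF
    _ = ∑ x ∈ V.image (fun v => ((a v).gcd N, a v / (a v).gcd N)), (x.1.totient : ℝ) / (N * β) := by
        rw [Finset.sum_image]
        intro x hx y hy h
        apply ia hx hy
        simp only [Prod.mk.injEq] at h
        rw [← Nat.div_mul_cancel (Nat.gcd_dvd_left (a x) N), h.2, h.1,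
          Nat.div_mul_cancel (Nat.gcd_dvd_left (a y) N)]
    _ ≤ ∑ x ∈ N.divisors ×ˢ Finset.Icc 1 ⌊L * β⌋₊, (x.1.totient : ℝ) / (N * β) := by
        apply Finset.sum_le_sum_of_subset_of_nonneg
        · intro x hx
          rw [Finset.mem_image] at hx
          obtain ⟨v, hv, rfl⟩ := hx
          rw [Finset.mem_product, Nat.mem_divisors, Finset.mem_Icc]
          refine ⟨⟨Nat.gcd_dvd_right _ _, hN⟩, ?_, Nat.le_floor (hV v hv)⟩
          exact Nat.div_pos (Nat.gcd_le_left _ (Nat.pos_of_ne_zero (ha0 v hv)))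
            (Nat.gcd_pos_of_pos_right _ (Nat.pos_of_ne_zero hN))
        · intros; positivity
    _ = (∑ d ∈ N.divisors, (d.totient : ℝ)) * ⌊L * β⌋₊ / (N * β) := by
        rw [Finset.sum_product]
        simp only [Finset.sum_const, Nat.card_Icc, Nat.add_sub_cancel, nsmul_eq_mul]
        rw [Finset.sum_mul, Finset.sum_div]
        refine Finset.sum_congr rfl fun d _ => ?_
        ring
    _ = ⌊L * β⌋₊ / β := by
        have : (∑ d ∈ N.divisors, (d.totient : ℝ)) = N := by exact_mod_cast Nat.sum_totient N
        rw [this]; field_simp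
    _ ≤ L := by
        rw [div_le_iff₀ hβ]; exact Nat.floor_le (by positivity)

theorem structured {S V W : Finset ℕ} {E : Finset (ℕ × ℕ)} {a b : ℕ → ℕ} {F G : ℕ → ℝ}
    (h : Sys S V W E a b F G) {N : ℕ} (hN : N ≠ 0) 
    (hg : ∀ e ∈ E, N * (a e.1).gcd (b e.2) ≤ (a e.1).gcd N * (b e.2).gcd N)
    {l : ℝ} (hl : 0 < l) :
    ∑ e ∈ E, F e.1 * G e.2 ≤ l * ∑ w ∈ W, G w + l⁻¹ * ∑ v ∈ V, F v := by
  classical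
  have hN' : (0:ℝ) < N := by exact_mod_cast Nat.pos_of_ne_zero hN
  have gp : ∀ n : ℕ, 0 < n.gcd N := fun n => Nat.gcd_pos_of_pos_right _ (Nat.pos_of_ne_zero hN)
  have dp : ∀ n : ℕ, n ≠ 0 → 0 < n / n.gcd N := fun n hn =>
    Nat.div_pos (Nat.gcd_le_left _ (Nat.pos_of_ne_zero hn)) (gp n)
  have tot : ∀ n : ℕ, n.totient * n.gcd N ≤ (n.gcd N).totient * n := by
    intro n
    obtain ⟨c, hc⟩ := Nat.gcd_dvd_left n N
    have h1 : n.totient ≤ (n.gcd N).totient * c := by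
      conv_lhs => rw [hc]
      exact tot_mul_le _ _
    calc n.totient * n.gcd N ≤ ((n.gcd N).totient * c) * n.gcd N := Nat.mul_le_mul_right _ h1
      _ = (n.gcd N).totient * (n.gcd N * c) := by ring
      _ = _ := by rw [← hc]
  have gen : ∀ (x y : ℕ) (f : ℝ), x ≠ 0 → y ≠ 0 → 0 ≤ f →
      N * x.gcd y ≤ x.gcd N * y.gcd N → f * x * y ≤ x.totient * x.gcd y →
      f ≤ (x.gcd N).totient / (N * (y / y.gcd N : ℕ)) := by
    intro x y f hx hy hf h1 h2
    have hd : (0:ℝ) < (y / y.gcd N : ℕ) := by exact_mod_cast dp y hy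
    have hyd : (y:ℝ) = (y / y.gcd N : ℕ) * (y.gcd N) := by
      exact_mod_cast (Nat.div_mul_cancel (Nat.gcd_dvd_left y N)).symm
    rw [le_div_iff₀ (by positivity)]
    have hx' : (0:ℝ) < x := by exact_mod_cast Nat.pos_of_ne_zero hx
    have hgy : (0:ℝ) < (y.gcd N) := by exact_mod_cast gp y
    have h1' : (N:ℝ) * x.gcd y ≤ x.gcd N * y.gcd N := by exact_mod_cast h1
    have h3 : (x.totient : ℝ) * x.gcd N ≤ (x.gcd N).totient * x := by exact_mod_cast tot x
    have hpos : (0:ℝ) < x * y.gcd N := by positivity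
    refine le_of_mul_le_mul_left ?_ hpos
    calc (x:ℝ) * y.gcd N * (f * (N * (y / y.gcd N : ℕ)))
        = N * (f * x * ((y / y.gcd N : ℕ) * y.gcd N)) := by ring
      _ = N * (f * x * y) := by rw [← hyd]
      _ ≤ N * (x.totient * x.gcd y) := by gcongr
      _ = x.totient * (N * x.gcd y) := by ring
      _ ≤ x.totient * (x.gcd N * y.gcd N) := by gcongr
      _ = (x.totient * x.gcd N) * y.gcd N := by ring
      _ ≤ ((x.gcd N).totient * x) * y.gcd N := by gcongr
      _ = _ := by ring
  let A : ℕ → ℝ := fun v => ((a v / (a v).gcd N : ℕ) : ℝ)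
  let B : ℕ → ℝ := fun w => ((b w / (b w).gcd N : ℕ) : ℝ)
  rw [← Finset.sum_filter_add_sum_filter_not E (fun e => A e.1 ≤ l * B e.2)]
  apply add_le_add
  · calc ∑ e ∈ E.filter (fun e => A e.1 ≤ l * B e.2), F e.1 * G e.2
        = ∑ w ∈ W, ∑ e ∈ (E.filter (fun e => A e.1 ≤ l * B e.2)).filter (fun e => e.2 = w), F e.1 * G e.2 := by
          rw [Finset.sum_fiberwise_of_maps_to]
          intro e he; exact h.eW e (Finset.mem_filter.1 he).1
      _ ≤ ∑ w ∈ W, l * G w := by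
          refine Finset.sum_le_sum fun w hw => ?_
          have : ∑ e ∈ (E.filter (fun e => A e.1 ≤ l * B e.2)).filter (fun e => e.2 = w), F e.1 * G e.2
            = (∑ v ∈ ((E.filter (fun e => A e.1 ≤ l * B e.2)).filter (fun e => e.2 = w)).image Prod.fst, F v)
              * G w := by
            rw [Finset.sum_image, Finset.sum_mul]
            · refine Finset.sum_congr rfl fun e he => ?_
              rw [(Finset.mem_filter.1 he).2]
            · intro x hx y hy hxy
              simp only [Finset.coe_filter, Set.mem_ofPred_eq] at hx hy
              exact Prod.ext hxy (hx.2.trans hy.2.symm)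
          rw [this]
          refine mul_le_mul_of_nonneg_right ?_ (h.G0 w)
          have hm : ∀ v ∈ ((E.filter (fun e => A e.1 ≤ l * B e.2)).filter (fun e => e.2 = w)).image Prod.fst,
              (v, w) ∈ E ∧ A v ≤ l * B w := by
            intro v hv
            simp only [Finset.mem_image, Finset.mem_filter] at hv
            obtain ⟨⟨e1, e2⟩, ⟨⟨h1, h2⟩, h3⟩, h4⟩ := hv
            dsimp only at h1 h2 h3 h4
            subst h3; subst h4; exact ⟨h1, h2⟩
          refine structured_half hN _ a F (h.ia.mono fun v hv => h.eV _ (hm v hv).1)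
            (fun v hv => (h.pa v (h.eV _ (hm v hv).1)).1)
            (β := B w) (by simp only [B]; exact_mod_cast dp _ (h.pb w hw).1) hl.le ?_ ?_
          · intro v hv
            have := (hm v hv).1
            exact gen _ _ _ (h.pa v (h.eV _ this)).1 (h.pb w hw).1 (h.F0 v) (hg _ this) (h.dF _ this)
          · intro v hv; exact (hm v hv).2
      _ = l * ∑ w ∈ W, G w := by rw [Finset.mul_sum]
  · calc ∑ e ∈ E.filter (fun e => ¬ A e.1 ≤ l * B e.2), F e.1 * G e.2
        = ∑ v ∈ V, ∑ e ∈ (E.filter (fun e => ¬ A e.1 ≤ l * B e.2)).filter (fun e => e.1 = v), F e.1 * G e.2 := by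
          rw [Finset.sum_fiberwise_of_maps_to]
          intro e he; exact h.eV e (Finset.mem_filter.1 he).1
      _ ≤ ∑ v ∈ V, l⁻¹ * F v := by
          refine Finset.sum_le_sum fun v hv => ?_
          have : ∑ e ∈ (E.filter (fun e => ¬ A e.1 ≤ l * B e.2)).filter (fun e => e.1 = v), F e.1 * G e.2
            = (∑ w ∈ ((E.filter (fun e => ¬ A e.1 ≤ l * B e.2)).filter (fun e => e.1 = v)).image Prod.snd, G w)
              * F v := by
            rw [Finset.sum_image, Finset.sum_mul]
            · refine Finset.sum_congr rfl fun e he => ?_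
              rw [(Finset.mem_filter.1 he).2, mul_comm]
            · intro x hx y hy hxy
              simp only [Finset.coe_filter, Set.mem_ofPred_eq] at hx hy
              exact Prod.ext (hx.2.trans hy.2.symm) hxy
          rw [this]
          refine mul_le_mul_of_nonneg_right ?_ (h.F0 v)
          have hm : ∀ w ∈ ((E.filter (fun e => ¬ A e.1 ≤ l * B e.2)).filter (fun e => e.1 = v)).image Prod.snd,
              (v, w) ∈ E ∧ B w ≤ l⁻¹ * A v := by
            intro w hw
            simp only [Finset.mem_image, Finset.mem_filter] at hw
            obtain ⟨⟨e1, e2⟩, ⟨⟨h1, h2⟩, h3⟩, h4⟩ := hw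
            dsimp only at h1 h2 h3 h4
            subst h3; subst h4; refine ⟨h1, ?_⟩
            rw [inv_mul_eq_div, le_div_iff₀ hl]; linarith
          refine structured_half hN _ b G (h.ib.mono fun w hw => h.eW _ (hm w hw).1)
            (fun w hw => (h.pb w (h.eW _ (hm w hw).1)).1)
            (β := A v) (by simp only [A]; exact_mod_cast dp _ (h.pa v hv).1) (inv_nonneg.2 hl.le) ?_ ?_
          · intro w hw
            have := (hm w hw).1
            have h1 := hg _ this
            have h2 := h.dG _ this
            rw [Nat.gcd_comm, mul_comm ((a _).gcd N)] at h1
            rw [Nat.gcd_comm] at h2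
            exact gen _ _ _ (h.pb w (h.eW _ this)).1 (h.pa v hv).1 (h.G0 w) h1 h2
          · intro w hw; exact (hm w hw).2
      _ = l⁻¹ * ∑ v ∈ V, F v := by rw [Finset.mul_sum]

theorem good_gcd {S : Finset ℕ} (hS : ∀ p ∈ S, p.Prime) (k : ℕ → ℕ) {x y : ℕ} (hx : x ≠ 0) (hy : y ≠ 0)
    (hxS : x.primeFactors ⊆ S)
    (h : ∀ p ∈ S, x.factorization p = k p ∨ y.factorization p = k p) :
    (∏ p ∈ S, p ^ k p) * x.gcd y ≤ x.gcd (∏ p ∈ S, p ^ k p) * y.gcd (∏ p ∈ S, p ^ k p) := by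
  set N := ∏ p ∈ S, p ^ k p with hNdef
  have hN : N ≠ 0 := Finset.prod_ne_zero_iff.2 fun p hp => pow_ne_zero _ (hS p hp).ne_zero
  have hf : ∀ p ∈ S, N.factorization p = k p := by
    intro p hp
    rw [hNdef, Nat.factorization_prod (fun q hq => pow_ne_zero _ (hS q hq).ne_zero), Finsupp.finsetSum_apply]
    rw [Finset.sum_eq_single p]
    · simp [(hS p hp).factorization_self]
    · intro q hq hqp
      rw [(hS q hq).factorization_pow]
      simp [hqp]
    · exact fun h => absurd hp h
  have g0 : x.gcd N ≠ 0 := Nat.gcd_ne_zero_left hx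
  have g1 : y.gcd N ≠ 0 := Nat.gcd_ne_zero_left hy
  have g2 : x.gcd y ≠ 0 := Nat.gcd_ne_zero_left hx
  apply Nat.le_of_dvd (Nat.pos_of_ne_zero (mul_ne_zero g0 g1))
  rw [← Nat.factorization_le_iff_dvd (mul_ne_zero hN g2) (mul_ne_zero g0 g1)]
  intro p
  rw [Nat.factorization_mul hN g2, Nat.factorization_mul g0 g1, Nat.factorization_gcd hx hN,
    Nat.factorization_gcd hy hN, Nat.factorization_gcd hx hy]
  simp only [Finsupp.add_apply, Finsupp.inf_apply]
  by_cases hp : p ∈ S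
  · have := hf p hp
    rcases h p hp with h | h <;> · rw [h, this]; omega
  · have h1 : x.factorization p = 0 := Finsupp.notMem_support_iff.1 (fun h => hp (hxS h))
    have h3 : N.factorization p = 0 := by
      rw [hNdef, Nat.factorization_prod (fun q hq => pow_ne_zero _ (hS q hq).ne_zero), Finsupp.finsetSum_apply]
      apply Finset.sum_eq_zero
      intro q hq
      rw [(hS q hq).factorization_pow]
      have : q ≠ p := by rintro rfl; exact hp hq
      simp [this]
    rw [h1, h3]; simp

theorem bu_le (S : Finset ℕ) (A : ℕ → Finset (ℕ × ℕ)) (f : ℕ × ℕ → ℝ) (hf : ∀ e, 0 ≤ f e) :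
    ∑ e ∈ S.biUnion A, f e ≤ ∑ p ∈ S, ∑ e ∈ A p, f e := by
  classical
  induction S using Finset.induction_on with
  | empty => simp
  | insert p S hp ih =>
    rw [Finset.biUnion_insert, Finset.sum_insert hp]
    have := Finset.sum_union_inter (s₁ := A p) (s₂ := S.biUnion A) (f := f)
    have h0 : 0 ≤ ∑ e ∈ A p ∩ S.biUnion A, f e := Finset.sum_nonneg fun e _ => hf e
    linarith

theorem Sys.package {S V W : Finset ℕ} {E : Finset (ℕ × ℕ)} {a b : ℕ → ℕ} {F G : ℕ → ℝ}
    (h : Sys S V W E a b F G) {t C : ℝ} (ht : 0 < t) {p : ℕ} (hp : p.Prime)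
    (hB : Bd t C (S.erase p)) (hX : 0 < ∑ v ∈ V, F v) (hY : 0 < ∑ w ∈ W, G w) :
    ∃ (T : Finset ℕ) (α β : ℕ → ℝ), (∀ i, 0 ≤ α i) ∧ (∀ i, 0 ≤ β i) ∧ ∑ i ∈ T, α i = 1 ∧
      ∑ i ∈ T, β i = 1 ∧
      ∑ e ∈ E, F e.1 * G e.2 ≤ C * ((∑ v ∈ V, F v) ^ t * (∑ w ∈ W, G w) ^ t) *
        ∑ i ∈ T, ∑ j ∈ T, ker ((p:ℝ) ^ (-(1 - t))) i j * (α i ^ t * β j ^ t) ∧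
      ∀ k, ∑ e ∈ E.filter (fun e => (a e.1).factorization p ≠ k ∧ (b e.2).factorization p ≠ k),
          F e.1 * G e.2 ≤ C * ((∑ v ∈ V, F v) ^ t * (∑ w ∈ W, G w) ^ t) *
        ∑ i ∈ T.erase k, ∑ j ∈ T.erase k, ker ((p:ℝ) ^ (-(1 - t))) i j * (α i ^ t * β j ^ t) := by
  classical
  set X := ∑ v ∈ V, F v with hXd
  set Y := ∑ w ∈ W, G w with hYd
  set T := V.image (fun v => (a v).factorization p) ∪ W.image (fun w => (b w).factorization p) with hT
  set Xi : ℕ → ℝ := fun i => ∑ v ∈ V.filter (fun v => (a v).factorization p = i), F v with hXi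
  set Yj : ℕ → ℝ := fun j => ∑ w ∈ W.filter (fun w => (b w).factorization p = j), G w with hYj
  have Xi0 : ∀ i, 0 ≤ Xi i := fun i => Finset.sum_nonneg fun v _ => h.F0 v
  have Yj0 : ∀ i, 0 ≤ Yj i := fun i => Finset.sum_nonneg fun v _ => h.G0 v
  have hTV : ∀ v ∈ V, (a v).factorization p ∈ T := fun v hv =>
    Finset.mem_union_left _ (Finset.mem_image_of_mem _ hv)
  have hTW : ∀ w ∈ W, (b w).factorization p ∈ T := fun v hv =>
    Finset.mem_union_right _ (Finset.mem_image_of_mem _ hv)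
  have sl : ∀ i j, ∑ e ∈ E.filter (fun e => (a e.1).factorization p = i ∧ (b e.2).factorization p = j),
      F e.1 * G e.2 ≤ C * (X ^ t * Y ^ t) *
        (ker ((p:ℝ) ^ (-(1 - t))) i j * ((Xi i / X) ^ t * (Yj j / Y) ^ t)) := by
    intro i j
    refine (h.slice ht hp hB i j).trans (le_of_eq ?_)
    rw [Real.div_rpow (Xi0 i) hX.le, Real.div_rpow (Yj0 j) hY.le]
    have : X ^ t ≠ 0 := (Real.rpow_pos_of_pos hX t).ne'
    have : Y ^ t ≠ 0 := (Real.rpow_pos_of_pos hY t).ne'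
    field_simp
    rfl
  have dec : ∀ (E' : Finset (ℕ × ℕ)) (T' : Finset ℕ), E' ⊆ E →
      (∀ e ∈ E', (a e.1).factorization p ∈ T' ∧ (b e.2).factorization p ∈ T') →
      ∑ e ∈ E', F e.1 * G e.2 ≤ C * (X ^ t * Y ^ t) *
        ∑ i ∈ T', ∑ j ∈ T', ker ((p:ℝ) ^ (-(1 - t))) i j * ((Xi i / X) ^ t * (Yj j / Y) ^ t) := by
    intro E' T' hE' hm
    rw [← Finset.sum_product' (f := fun i j =>
      ker ((p:ℝ) ^ (-(1 - t))) i j * ((Xi i / X) ^ t * (Yj j / Y) ^ t)), Finset.mul_sum,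
      ← Finset.sum_fiberwise_of_maps_to (s := E') (t := T' ×ˢ T')
      (g := fun e => ((a e.1).factorization p, (b e.2).factorization p))
      (fun e he => Finset.mem_product.2 (hm e he))]
    refine Finset.sum_le_sum fun ij _ => le_trans ?_ (sl ij.1 ij.2)
    apply Finset.sum_le_sum_of_subset_of_nonneg
    · intro e he
      rw [Finset.mem_filter] at he ⊢
      refine ⟨hE' he.1, ?_⟩
      rw [← he.2]; exact ⟨rfl, rfl⟩
    · intro e _ _; exact mul_nonneg (h.F0 _) (h.G0 _)
  refine ⟨T, fun i => Xi i / X, fun j => Yj j / Y, fun i => div_nonneg (Xi0 i) hX.le,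
    fun i => div_nonneg (Yj0 i) hY.le, ?_, ?_, ?_, ?_⟩
  · rw [← Finset.sum_div, hXi, Finset.sum_fiberwise_of_maps_to hTV]; exact div_self hX.ne'
  · rw [← Finset.sum_div, hYj, Finset.sum_fiberwise_of_maps_to hTW]; exact div_self hY.ne'
  · exact dec E T subset_rfl fun e he => ⟨hTV _ (h.eV e he), hTW _ (h.eW e he)⟩
  · intro k
    refine dec _ (T.erase k) (Finset.filter_subset _ _) fun e he => ?_
    rw [Finset.mem_filter] at he
    exact ⟨Finset.mem_erase.2 ⟨he.2.1, hTV _ (h.eV e he.1)⟩,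
      Finset.mem_erase.2 ⟨he.2.2, hTW _ (h.eW e he.1)⟩⟩

theorem Sys.le_mul {S V W : Finset ℕ} {E : Finset (ℕ × ℕ)} {a b : ℕ → ℕ} {F G : ℕ → ℝ}
    (h : Sys S V W E a b F G) :
    ∑ e ∈ E, F e.1 * G e.2 ≤ (∑ v ∈ V, F v) * ∑ w ∈ W, G w := by
  rw [Finset.sum_mul_sum, ← Finset.sum_product']
  apply Finset.sum_le_sum_of_subset_of_nonneg
  · intro e he; exact Finset.mem_product.2 ⟨h.eV e he, h.eW e he⟩
  · intro e _ _; exact mul_nonneg (h.F0 _) (h.G0 _)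

theorem Sys.mono {S V W : Finset ℕ} {E E' : Finset (ℕ × ℕ)} {a b : ℕ → ℕ} {F G : ℕ → ℝ}
    (h : Sys S V W E a b F G) (hE : E' ⊆ E) : Sys S V W E' a b F G :=
  { h with
    eV := fun e he => h.eV e (hE he)
    eW := fun e he => h.eW e (hE he)
    dF := fun e he => h.dF e (hE he)
    dG := fun e he => h.dG e (hE he) }

theorem small_step {t C ρ : ℝ} (ht : 1 / 2 < t) (hC : 0 ≤ C) (hρ1 : ρ < 1)
    {S : Finset ℕ} {p : ℕ} (hp : p.Prime) (hpρ : (p:ℝ) ^ (-(1 - t)) ≤ ρ)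
    (hB : Bd t C (S.erase p)) : Bd t (C * (1 + 2 * ρ / (1 - ρ))) S := by
  intro V W E a b F G h
  have hp0 : (0:ℝ) < p := by exact_mod_cast hp.pos
  have hr0 : 0 ≤ (p:ℝ) ^ (-(1 - t)) := by positivity
  have hρ0 : 0 ≤ ρ := hr0.trans hpρ
  have hR0 : 0 ≤ 1 + 2 * ρ / (1 - ρ) := by
    have : 0 < 1 - ρ := by linarith
    positivity
  have X0 : 0 ≤ ∑ v ∈ V, F v := Finset.sum_nonneg fun v _ => h.F0 v
  have Y0 : 0 ≤ ∑ v ∈ W, G v := Finset.sum_nonneg fun v _ => h.G0 v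
  have hle := h.le_mul
  have hnn : 0 ≤ C * (1 + 2 * ρ / (1 - ρ)) * ((∑ v ∈ V, F v) ^ t * (∑ w ∈ W, G w) ^ t) := by positivity
  rcases X0.eq_or_lt with hX | hX
  · rw [← hX, zero_mul] at hle; linarith
  rcases Y0.eq_or_lt with hY | hY
  · rw [← hY, mul_zero] at hle; linarith
  obtain ⟨T, α, β, hα, hβ, sα, sβ, hs, -⟩ := h.package (by linarith) hp hB hX hY
  have := schur_rpow (T := T) (k := ker ((p:ℝ) ^ (-(1 - t)))) (fun i j => ker_nonneg hr0 i j)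
    (ker_comm _) (R := 1 + 2 * ρ / (1 - ρ)) (fun i => le_trans (Finset.sum_le_sum fun j _ =>
      (pow_le_pow_left₀ hr0 hpρ _ : ker _ i j ≤ ker ρ i j)) (row_all hρ0 hρ1 T i)) hR0 hα hβ ht sα.le sβ.le
  rw [Real.one_rpow] at this
  calc _ ≤ _ := hs
    _ ≤ C * ((∑ v ∈ V, F v) ^ t * (∑ w ∈ W, G w) ^ t) * ((1 + 2 * ρ / (1 - ρ)) * ((1 + 1) / 2)) := by
        gcongr
    _ = _ := by ring

theorem large_step {t r₀ c : ℝ} (ht : 1 / 2 < t) (ht1 : t < 1)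
    (hr : ∀ r : ℝ, 0 < r → r ≤ r₀ → ∀ (T : Finset ℕ) (α β : ℕ → ℝ),
      (∀ i, 0 ≤ α i) → (∀ i, 0 ≤ β i) → ∑ i ∈ T, α i = 1 → ∑ i ∈ T, β i = 1 →
      1 ≤ ∑ i ∈ T, ∑ j ∈ T, ker r i j * (α i ^ t * β j ^ t) →
      ∃ k : ℕ, ∑ i ∈ T.erase k, ∑ j ∈ T.erase k, ker r i j * (α i ^ t * β j ^ t)
        ≤ 3 * ((43 * r) ^ (1 / (1 - t))) ^ (2 * t))
    (hc : c = 3 * ((43:ℝ) ^ (1 / (1 - t))) ^ (2 * t))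
    {S : Finset ℕ} (hS : ∀ p ∈ S, p.Prime) (hSr : ∀ p ∈ S, (p:ℝ) ^ (-(1 - t)) ≤ r₀)
    (hsum : ∑ p ∈ S, c * (p:ℝ) ^ (-(2 * t)) ≤ 1 / 2)
    (hB : ∀ p ∈ S, Bd t 4 (S.erase p)) : Bd t 4 S := by
  classical
  intro V W E a b F G h
  have X0 : 0 ≤ ∑ v ∈ V, F v := Finset.sum_nonneg fun v _ => h.F0 v
  have Y0 : 0 ≤ ∑ v ∈ W, G v := Finset.sum_nonneg fun v _ => h.G0 v
  have hle := h.le_mul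
  have hpk := fun (p : ℕ) (hp : p ∈ S) hX hY => h.package (by linarith) (hS p hp) (hB p hp) hX hY
  set X := ∑ v ∈ V, F v with hXd
  set Y := ∑ w ∈ W, G w with hYd
  have hnn : 0 ≤ 4 * (X ^ t * Y ^ t) := by positivity
  rcases X0.eq_or_lt with hX | hX
  · rw [← hX, zero_mul] at hle; linarith
  rcases Y0.eq_or_lt with hY | hY
  · rw [← hY, mul_zero] at hle; linarith
  have hXY : 0 < X * Y := mul_pos hX hY
  have hXYt : X ^ t * Y ^ t = (X * Y) ^ t := (Real.mul_rpow hX.le hY.le).symm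
  by_contra hcon
  push Not at hcon
  set m := ∑ e ∈ E, F e.1 * G e.2 with hm
  set P := X ^ t * Y ^ t with hP
  have hP0 : 0 < P := by positivity
  have h1 : 1 ≤ X * Y := by
    by_contra h1
    push Not at h1
    have : X * Y ≤ (X * Y) ^ t := by
      conv_lhs => rw [← Real.rpow_one (X * Y)]
      exact Real.rpow_le_rpow_of_exponent_ge hXY h1.le ht1.le
    rw [← hXYt] at this
    linarith
  have hk : ∀ p ∈ S, ∃ k, ∑ e ∈ E.filter
      (fun e => (a e.1).factorization p ≠ k ∧ (b e.2).factorization p ≠ k), F e.1 * G e.2 ≤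
      c * (p:ℝ) ^ (-(2 * t)) * m := by
    intro p hp
    have hp0 : (0:ℝ) < p := by exact_mod_cast (hS p hp).pos
    obtain ⟨T, α, β, hα, hβ, sα, sβ, hs, hk⟩ := hpk p hp hX hY
    obtain ⟨k, hk'⟩ := hr _ (by positivity) (hSr p hp) T α β hα hβ sα sβ (by
      by_contra hlt
      push Not at hlt
      have := mul_le_mul_of_nonneg_left hlt.le hnn
      linarith)
    refine ⟨k, (hk k).trans ?_⟩
    have e : 3 * ((43 * (p:ℝ) ^ (-(1 - t))) ^ (1 / (1 - t))) ^ (2 * t) = c * (p:ℝ) ^ (-(2 * t)) := by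
      rw [hc, Real.mul_rpow (by norm_num) (by positivity), ← Real.rpow_mul hp0.le,
        Real.mul_rpow (by positivity) (by positivity), ← Real.rpow_mul hp0.le]
      have : -(1 - t) * (1 / (1 - t)) * (2 * t) = -(2 * t) := by
        have : 1 - t ≠ 0 := by linarith
        field_simp
      rw [this]; ring
    rw [e] at hk'
    have hc0 : 0 ≤ c * (p:ℝ) ^ (-(2 * t)) := by rw [hc]; positivity
    calc _ ≤ 4 * P * (c * (p:ℝ) ^ (-(2 * t))) := mul_le_mul_of_nonneg_left hk' hnn
      _ ≤ m * (c * (p:ℝ) ^ (-(2 * t))) := mul_le_mul_of_nonneg_right hcon.le hc0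
      _ = _ := mul_comm _ _
  choose! k hk using hk
  have hm0 : 0 ≤ m := Finset.sum_nonneg fun e _ => mul_nonneg (h.F0 _) (h.G0 _)
  let good : ℕ × ℕ → Prop := fun e => ∀ p ∈ S, (a e.1).factorization p = k p ∨ (b e.2).factorization p = k p
  have hbad : ∑ e ∈ E.filter (fun e => ¬ good e), F e.1 * G e.2 ≤ 1 / 2 * m := by
    calc ∑ e ∈ E.filter (fun e => ¬ good e), F e.1 * G e.2
        ≤ ∑ e ∈ S.biUnion (fun p => E.filter
          (fun e => (a e.1).factorization p ≠ k p ∧ (b e.2).factorization p ≠ k p)), F e.1 * G e.2 := by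
          apply Finset.sum_le_sum_of_subset_of_nonneg
          · intro e he
            simp only [good, Finset.mem_filter, Finset.mem_biUnion] at he ⊢
            obtain ⟨he1, he2⟩ := he
            push Not at he2
            obtain ⟨p, hp, h2⟩ := he2
            exact ⟨p, hp, he1, h2⟩
          · intro e _ _; exact mul_nonneg (h.F0 _) (h.G0 _)
      _ ≤ ∑ p ∈ S, ∑ e ∈ E.filter
          (fun e => (a e.1).factorization p ≠ k p ∧ (b e.2).factorization p ≠ k p), F e.1 * G e.2 :=
          bu_le S _ _ fun e => mul_nonneg (h.F0 _) (h.G0 _)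
      _ ≤ ∑ p ∈ S, c * (p:ℝ) ^ (-(2 * t)) * m := Finset.sum_le_sum hk
      _ ≤ 1 / 2 * m := by
          rw [← Finset.sum_mul]; exact mul_le_mul_of_nonneg_right hsum hm0
  have hgood := structured (h.mono (Finset.filter_subset good E)) (N := ∏ p ∈ S, p ^ k p)
    (Finset.prod_ne_zero_iff.2 fun p hp => pow_ne_zero _ (hS p hp).ne_zero) (fun e he => by
      have he' := Finset.mem_filter.1 he
      exact good_gcd hS k (h.pa _ (h.eV e he'.1)).1 (h.pb _ (h.eW e he'.1)).1
        (h.pa _ (h.eV e he'.1)).2 he'.2) (l := Real.sqrt (X / Y)) (Real.sqrt_pos.2 (div_pos hX hY))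
  have hsplit := Finset.sum_filter_add_sum_filter_not E good (fun e => F e.1 * G e.2)
  have e1 : Real.sqrt (X / Y) * Y = Real.sqrt (X * Y) := by
    rw [Real.sqrt_div hX.le, Real.sqrt_mul hX.le]
    have := Real.sqrt_pos.2 hY
    field_simp
    rw [Real.sq_sqrt hY.le]
  have e2 : (Real.sqrt (X / Y))⁻¹ * X = Real.sqrt (X * Y) := by
    rw [Real.sqrt_div hX.le, Real.sqrt_mul hX.le]
    have := Real.sqrt_pos.2 hY
    have := Real.sqrt_pos.2 hX
    field_simp
    rw [Real.sq_sqrt hX.le]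
  rw [← hXd, ← hYd, e1, e2] at hgood
  have h2 : Real.sqrt (X * Y) ≤ P := by
    rw [hXYt, Real.sqrt_eq_rpow]
    exact Real.rpow_le_rpow_of_exponent_le h1 ht.le
  rw [← hm] at hsplit
  linarith

theorem main_bd {t : ℝ} (ht : 1 / 2 < t) (ht1 : t < 1) :
    ∃ C : ℝ, 0 < C ∧ ∀ S : Finset ℕ, (∀ p ∈ S, p.Prime) → Bd t C S := by
  classical
  obtain ⟨r₀, hr0, hr⟩ := concentration ht ht1
  set c := 3 * ((43:ℝ) ^ (1 / (1 - t))) ^ (2 * t) with hc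
  have hc0 : 0 < c := by positivity
  have hsm : Summable (fun n : ℕ => c * (n:ℝ) ^ (-(2 * t))) :=
    (Real.summable_nat_rpow.2 (by linarith)).mul_left c
  obtain ⟨s, hs⟩ := summable_iff_vanishing_norm.1 hsm (1 / 2) (by norm_num)
  have hev : ∀ᶠ n : ℕ in Filter.atTop, (n:ℝ) ^ (-(1 - t)) ≤ r₀ :=
    ((tendsto_rpow_neg_atTop (by linarith : 0 < 1 - t)).comp tendsto_natCast_atTop_atTop).eventually_le_const hr0
  obtain ⟨n0, hn0⟩ := Filter.eventually_atTop.1 hev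
  set p0 := max n0 (s.sup id) with hp0
  set ρ : ℝ := (2:ℝ) ^ (-(1 - t)) with hρ
  have hρ0 : 0 < ρ := by positivity
  have hρ1 : ρ < 1 := Real.rpow_lt_one_of_one_lt_of_neg (by norm_num) (by linarith)
  set B := 1 + 2 * ρ / (1 - ρ) with hBd
  have hB1 : 1 ≤ B := by
    have : 0 < 1 - ρ := by linarith
    have : 0 ≤ 2 * ρ / (1 - ρ) := by positivity
    linarith
  have main : ∀ S : Finset ℕ, (∀ p ∈ S, p.Prime) → Bd t (4 * B ^ (S.filter (fun p => p ≤ p0)).card) S := by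
    intro S
    induction S using Finset.strongInduction with
    | H S ih =>
      intro hS
      have ih' : ∀ p ∈ S, Bd t (4 * B ^ ((S.erase p).filter (fun p => p ≤ p0)).card) (S.erase p) :=
        fun p hp => ih _ (Finset.erase_ssubset hp) fun q hq => hS q (Finset.mem_of_mem_erase hq)
      by_cases hex : ∃ p ∈ S, p ≤ p0
      · obtain ⟨p, hp, hpp⟩ := hex
        have hcard : ((S.erase p).filter (fun p => p ≤ p0)).card + 1 = (S.filter (fun p => p ≤ p0)).card := by
          rw [Finset.filter_erase]
          exact Finset.card_erase_add_one (Finset.mem_filter.2 ⟨hp, hpp⟩)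
        have := small_step ht (by positivity) hρ1 (hS p hp) (by
          rw [hρ]
          exact Real.rpow_le_rpow_of_nonpos (by norm_num) (by exact_mod_cast (hS p hp).two_le)
            (by linarith)) (ih' p hp)
        rw [← hcard, pow_succ, ← mul_assoc]; exact this
      · push Not at hex
        have hz : ∀ S' ⊆ S, (S'.filter (fun p => p ≤ p0)).card = 0 := by
          intro S' hS'
          rw [Finset.card_eq_zero, Finset.filter_eq_empty_iff]
          intro p hp; have := hex p (hS' hp); omega
        rw [hz S subset_rfl, pow_zero, mul_one]
        refine large_step ht ht1 hr hc hS (fun p hp => hn0 p ?_) ?_ fun p hp => ?_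
        · exact (le_max_left _ _).trans (hex p hp).le
        · refine (le_abs_self _).trans (hs S ?_).le
          rw [Finset.disjoint_left]
          intro p hp hps
          have h1 : p ≤ s.sup id := Finset.le_sup (f := id) hps
          have h2 := hex p hp
          have h3 := le_max_right n0 (s.sup id)
          omega
        · have := ih' p hp
          rwa [hz _ (Finset.erase_subset _ _), pow_zero, mul_one] at this
  refine ⟨4 * B ^ (p0 + 1), by positivity, fun S hS V W E a b F G h => ?_⟩
  refine (main S hS V W E a b F G h).trans ?_
  have X0 : 0 ≤ ∑ v ∈ V, F v := Finset.sum_nonneg fun v _ => h.F0 v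
  have Y0 : 0 ≤ ∑ v ∈ W, G v := Finset.sum_nonneg fun v _ => h.G0 v
  have hcard : (S.filter (fun p => p ≤ p0)).card ≤ p0 + 1 := by
    calc _ ≤ (Finset.range (p0 + 1)).card := Finset.card_le_card (by
          intro p hp; have := (Finset.mem_filter.1 hp).2; rw [Finset.mem_range]; omega)
      _ = _ := Finset.card_range _
  gcongr

/-- First bilinear estimate: for fixed `ε ∈ (0,1)`, uniformly in `ψ ≥ 0`, `Q ≥ 1`, `y ≥ 1`,
`∑∑_{(q,r) ∈ [1,Q]², D(q,r) ≤ y} (ψ(q)φ(q)/q)(ψ(r)φ(r)/r) ≪_ε y^{1-ε} Ψ(Q)^{1+ε}`. -/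
theorem bilinear_estimate_one (ε : ℝ) (hε : ε ∈ Set.Ioo (0 : ℝ) 1) :
    ∃ K : ℝ, 0 < K ∧ ∀ ψ : ℕ → ℝ, (∀ q, 0 ≤ ψ q) → ∀ Q : ℕ, 1 ≤ Q → ∀ y : ℝ, 1 ≤ y →
      (∑ q ∈ Finset.Icc 1 Q, ∑ r ∈ Finset.Icc 1 Q,
          if Dfun ψ q r ≤ y then
            ψ q * (Nat.totient q : ℝ) / q * (ψ r * (Nat.totient r : ℝ) / r)
          else 0)
        ≤ K * y ^ (1 - ε) * Psi ψ Q ^ (1 + ε) := by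
  classical
  obtain ⟨C, hC, hmain⟩ := main_bd (t := (1 + ε) / 2) (by linarith [hε.1]) (by linarith [hε.2])
  refine ⟨C, hC, fun ψ hψ Q _ y hy => ?_⟩
  have hy0 : 0 < y := by linarith
  set F : ℕ → ℝ := fun q => (Nat.totient q : ℝ) * ψ q / q / y with hF
  have hF0 : ∀ q, 0 ≤ F q := fun q => by have := hψ q; simp only [hF]; positivity
  have hpf : ∀ v ∈ Finset.Icc 1 Q, id v ≠ 0 ∧
      (id v).primeFactors ⊆ (Finset.Icc 1 Q).filter Nat.Prime := by
    intro v hv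
    rw [Finset.mem_Icc] at hv
    refine ⟨by simp only [id]; omega, fun p hp => ?_⟩
    have hp' := Nat.mem_primeFactors.1 hp
    have := Nat.le_of_dvd (by simp only [id]; omega) hp'.2.1
    simp only [id] at this
    exact Finset.mem_filter.2 ⟨Finset.mem_Icc.2 ⟨hp'.1.pos, by omega⟩, hp'.1⟩
  have hcond : ∀ q r : ℕ, q ∈ Finset.Icc 1 Q → (r:ℝ) * ψ q / (Nat.gcd q r : ℝ) ≤ y →
      F q * q * r ≤ q.totient * Nat.gcd q r := by
    intro q r hq h
    rw [Finset.mem_Icc] at hq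
    have hq0 : (0:ℝ) < q := by exact_mod_cast hq.1
    have hg : (0:ℝ) < Nat.gcd q r := by exact_mod_cast Nat.gcd_pos_of_pos_left r hq.1
    rw [div_le_iff₀ hg] at h
    have e : F q * q * r = q.totient * (r * ψ q / y) := by simp only [hF]; field_simp
    rw [e]
    refine mul_le_mul_of_nonneg_left ?_ (Nat.cast_nonneg _)
    rw [div_le_iff₀ hy0]; linarith
  have key := hmain ((Finset.Icc 1 Q).filter Nat.Prime) (fun p hp => (Finset.mem_filter.1 hp).2)
    (Finset.Icc 1 Q) (Finset.Icc 1 Q)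
    ((Finset.Icc 1 Q ×ˢ Finset.Icc 1 Q).filter (fun e => Dfun ψ e.1 e.2 ≤ y)) id id F F
    { F0 := hF0
      G0 := hF0
      ia := Set.injOn_id _
      ib := Set.injOn_id _
      pa := hpf
      pb := hpf
      eV := fun e he => (Finset.mem_product.1 (Finset.mem_filter.1 he).1).1
      eW := fun e he => (Finset.mem_product.1 (Finset.mem_filter.1 he).1).2
      dF := by
        intro e he
        obtain ⟨h1, h2⟩ := Finset.mem_filter.1 he
        refine hcond _ _ (Finset.mem_product.1 h1).1 (le_trans ?_ h2)
        exact div_le_div_of_nonneg_right (le_max_left _ _) (Nat.cast_nonneg _)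
      dG := by
        intro e he
        obtain ⟨h1, h2⟩ := Finset.mem_filter.1 he
        simp only [id]
        rw [Nat.gcd_comm]
        refine hcond _ _ (Finset.mem_product.1 h1).2 (le_trans ?_ h2)
        rw [Nat.gcd_comm]
        exact div_le_div_of_nonneg_right (le_max_right _ _) (Nat.cast_nonneg _) }
  set X := ∑ v ∈ Finset.Icc 1 Q, F v with hX
  have hX0 : 0 ≤ X := Finset.sum_nonneg fun v _ => hF0 v
  have hPsi : Psi ψ Q = 2 * (y * X) := by
    rw [Psi]
    congr 1
    rw [hX, Finset.mul_sum]
    refine Finset.sum_congr rfl fun q _ => ?_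
    simp only [hF]; field_simp
  have hLHS : (∑ q ∈ Finset.Icc 1 Q, ∑ r ∈ Finset.Icc 1 Q,
          if Dfun ψ q r ≤ y then
            ψ q * (Nat.totient q : ℝ) / q * (ψ r * (Nat.totient r : ℝ) / r)
          else 0) = y ^ 2 * ∑ e ∈ (Finset.Icc 1 Q ×ˢ Finset.Icc 1 Q).filter
            (fun e => Dfun ψ e.1 e.2 ≤ y), F e.1 * F e.2 := by
    rw [← Finset.sum_product' (f := fun q r => if Dfun ψ q r ≤ y then
            ψ q * (Nat.totient q : ℝ) / q * (ψ r * (Nat.totient r : ℝ) / r)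
          else 0), Finset.sum_filter, Finset.mul_sum]
    apply Finset.sum_congr rfl
    intro e _
    split_ifs
    · simp only [hF]; field_simp
    · simp
  rw [hLHS]
  have e1 : X ^ ((1 + ε) / 2) * X ^ ((1 + ε) / 2) = X ^ (1 + ε) := by
    rw [← Real.rpow_add_of_nonneg hX0 (by linarith [hε.1]) (by linarith [hε.1])]; congr 1; ring
  rw [e1] at key
  have e2 : y ^ (1 - ε) * (y * X) ^ (1 + ε) = y ^ 2 * X ^ (1 + ε) := by
    rw [Real.mul_rpow hy0.le hX0, ← mul_assoc, ← Real.rpow_add hy0]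
    congr 1
    rw [← Real.rpow_natCast]; congr 1; push_cast; ring
  calc _ ≤ y ^ 2 * (C * X ^ (1 + ε)) := mul_le_mul_of_nonneg_left key (by positivity)
    _ = C * y ^ (1 - ε) * (y * X) ^ (1 + ε) := by rw [mul_assoc C, e2]; ring
    _ ≤ C * y ^ (1 - ε) * Psi ψ Q ^ (1 + ε) := by
        refine mul_le_mul_of_nonneg_left ?_ (by positivity)
        refine Real.rpow_le_rpow (by positivity) ?_ (by linarith [hε.1])
        rw [hPsi]; nlinarith [mul_nonneg hy0.le hX0]
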